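/- arXiv:2507.16934 — 5 statements merged into one kernel-verified Lean document; each statement's English description precedes it below -/
import Mathlib

section
/- Let n ≥ 3 and let v₀, v₁, …, v_{n−1} be points in ℝ³ such that for every i with 1 ≤ i ≤ n−2 the triple (v₀, vᵢ, vᵢ₊₁) is affinely independent. If all n−3 sub-planarity constraints hold, i.e. ((vᵢ − v₀) × (vᵢ₊₁ − v₀)) ⋅ (vᵢ₊₂ − v₀) = 0 for every i with 1 ≤ i ≤ n−3, then all the points v₀, …, v_{n−1} lie in a common affine plane; more precisely, every vⱼ lies in the affine span of {v₀, v₁, v₂}. (This is the sufficiency part of Theorem 1: enforcing planarity between each pair of adjacent triangles in the fan triangulation of an n-sided polygonal facet ensures planarity of the entire facet.) -/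
open Matrix

/-- If the triple product of `a`, `b`, `c` vanishes and `a`, `b` are linearly independent, then
`c` lies in the span of `a` and `b`. -/
theorem mem_span_pair_of_crossProduct_dotProduct_eq_zero {a b c : Fin 3 → ℝ}
    (hab : LinearIndependent ℝ ![a, b]) (h : crossProduct a b ⬝ᵥ c = 0) :
    c ∈ Submodule.span ℝ {a, b} := by
  by_contra hc
  have hli : LinearIndependent ℝ ![c, a, b] := by
    refine linearIndependent_finCons.2 ⟨hab, ?_⟩
    simpa [Matrix.range_cons, Set.pair_comm] using hc
  rw [dotProduct_comm, triple_product_eq_det] at h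
  have hu := (Matrix.isUnit_iff_isUnit_det _).1
    ((Matrix.linearIndependent_rows_iff_isUnit (A := Matrix.of ![c, a, b])).1 hli)
  exact hu.ne_zero h

theorem AffineIndependent.linearIndependent_pair_sub {V : Type*} [AddCommGroup V] [Module ℝ V]
    {p q r : V} (h : AffineIndependent ℝ ![p, q, r]) :
    LinearIndependent ℝ ![q - p, r - p] := by
  rw [LinearIndependent.pair_iff]
  intro s t hst
  have hw := affineIndependent_iff.1 h Finset.univ ![-s - t, s, t]
    (by
      simp only [Fin.sum_univ_three, Matrix.cons_val]
      ring)
    (by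
      rw [← hst]
      simp only [Fin.sum_univ_three, Matrix.cons_val]
      module)
  exact ⟨by simpa using hw 1, by simpa using hw 2⟩

/-- An affine subspace containing an affinely independent triple of points in `ℝ³` contains every
point coplanar with them. -/
theorem AffineSubspace.mem_of_crossProduct_dotProduct_eq_zero
    {S : AffineSubspace ℝ (Fin 3 → ℝ)} {p q r x : Fin 3 → ℝ}
    (hp : p ∈ S) (hq : q ∈ S) (hr : r ∈ S) (hpqr : AffineIndependent ℝ ![p, q, r])
    (h : crossProduct (q - p) (r - p) ⬝ᵥ (x - p) = 0) : x ∈ S := by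
  have hx := mem_span_pair_of_crossProduct_dotProduct_eq_zero hpqr.linearIndependent_pair_sub h
  have hle : Submodule.span ℝ {q - p, r - p} ≤ S.direction := by
    rw [Submodule.span_le, Set.pair_subset_iff]
    exact ⟨S.vsub_mem_direction hq hp, S.vsub_mem_direction hr hp⟩
  simpa using AffineSubspace.vadd_mem_of_mem_direction (hle hx) hp

/-- **Sufficiency part of Theorem 1.** If all `n - 3` sub-planarity constraints of the fan
triangulation of an `n`-sided polygonal facet hold, then the whole facet is planar: every
vertex lies in the affine span of the first triangle `{v 0, v 1, v 2}`. -/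
theorem subplanarity_constraints_imply_planarity
    (n : ℕ) (hn : 3 ≤ n) (v : ℕ → Fin 3 → ℝ)
    (hindep : ∀ i : ℕ, 1 ≤ i → i ≤ n - 2 →
      AffineIndependent ℝ ![v 0, v i, v (i + 1)])
    (hplanar : ∀ i : ℕ, 1 ≤ i → i ≤ n - 3 →
      (crossProduct (v i - v 0) (v (i + 1) - v 0)) ⬝ᵥ (v (i + 2) - v 0) = 0) :
    ∀ j : ℕ, j ≤ n - 1 →
      v j ∈ affineSpan ℝ ({v 0, v 1, v 2} : Set (Fin 3 → ℝ)) := by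
  have key : ∀ k : ℕ, k + 2 ≤ n - 1 →
      v (k + 1) ∈ affineSpan ℝ ({v 0, v 1, v 2} : Set (Fin 3 → ℝ)) ∧
      v (k + 2) ∈ affineSpan ℝ ({v 0, v 1, v 2} : Set (Fin 3 → ℝ)) := by
    intro k
    induction k with
    | zero => exact fun _ => ⟨mem_affineSpan ℝ (by simp), mem_affineSpan ℝ (by simp)⟩
    | succ k ih =>
      intro hk
      obtain ⟨h₁, h₂⟩ := ih (by omega)
      exact ⟨h₂, AffineSubspace.mem_of_crossProduct_dotProduct_eq_zero
        (mem_affineSpan ℝ (by simp)) h₁ h₂ (hindep (k + 1) (by omega) (by omega))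
        (hplanar (k + 1) (by omega) (by omega))⟩
  intro j hj
  match j with
  | 0 => exact mem_affineSpan ℝ (by simp)
  | 1 => exact mem_affineSpan ℝ (by simp)
  | k + 2 => exact (key k hj).2
end

section
/- Let n ≥ 4 and let v₀, …, v_{n−1} be points in ℝ³ such that for every i with 1 ≤ i ≤ n−2 the triple (v₀, vᵢ, vᵢ₊₁) is affinely independent. Then for any natural number m ≤ n−4 and any linear functionals L₁, …, L_m on the space of vertex displacement fields (Fin n → ℝ³), there exists a displacement field u : Fin n → ℝ³ that preserves all 2n−3 edge constraints of the fan triangulation (i.e. (vᵢ − vⱼ) ⋅ (u(i) − u(j)) = 0 for every edge {i,j} of the fan triangulation), satisfies Lⱼ(u) = 0 for all j = 1, …, m, and is NOT an infinitesimal rigid motion, i.e. there are no ω, c ∈ ℝ³ with u(i) = ω × vᵢ + c for all i. (This is the necessity part of Theorem 1: fewer than n−3 additional planarity constraints cannot eliminate all non-trivial infinitesimal motions of the triangulated facet.) -/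
open Matrix

/-- The edge set of the fan triangulation of an `n`-sided polygonal facet: the boundary
edges `{i, i+1}` for `0 ≤ i ≤ n-2`, the closing edge `{n-1, 0}`, and the internal
diagonals `{0, i}` for `2 ≤ i ≤ n-2` (altogether `2n - 3` edges). -/
def IsFanEdge (n : ℕ) (i j : Fin n) : Prop :=
  ((i : ℕ) + 1 = (j : ℕ)) ∨ ((i : ℕ) = n - 1 ∧ (j : ℕ) = 0) ∨
    ((i : ℕ) = 0 ∧ 2 ≤ (j : ℕ) ∧ (j : ℕ) ≤ n - 2)

/-- A kernel cannot be contained in the range of a linear map from a space that is too small. -/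
theorem exists_mem_ker_notMem_range {K U V W : Type*} [DivisionRing K]
    [AddCommGroup U] [Module K U] [FiniteDimensional K U]
    [AddCommGroup V] [Module K V] [FiniteDimensional K V]
    [AddCommGroup W] [Module K W] [FiniteDimensional K W]
    (f : V →ₗ[K] W) (g : U →ₗ[K] V)
    (h : Module.finrank K U + Module.finrank K W < Module.finrank K V) :
    ∃ x, f x = 0 ∧ x ∉ LinearMap.range g := by
  by_contra! hc
  have hle : LinearMap.ker f ≤ LinearMap.range g := fun x hx => hc x hx
  have hker := Submodule.finrank_mono hle
  have hg := LinearMap.finrank_range_le g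
  have hf := f.finrank_range_add_finrank_ker
  have hW := (LinearMap.range f).finrank_le
  omega

/-- The first-order change of the squared length of the segment from `v i` to `v j`, up to a
factor of two, as a linear functional of the displacement field. -/
def edgeFunctional {ι : Type*} (v : ι → Fin 3 → ℝ) (i j : ι) :
    (ι → Fin 3 → ℝ) →ₗ[ℝ] ℝ :=
  dotProductBilin ℝ ℝ (v i - v j) ∘ₗ
    ((LinearMap.proj i : (ι → Fin 3 → ℝ) →ₗ[ℝ] Fin 3 → ℝ) - LinearMap.proj j)

theorem edgeFunctional_apply {ι : Type*} (v u : ι → Fin 3 → ℝ) (i j : ι) :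
    edgeFunctional v i j u = (v i - v j) ⬝ᵥ (u i - u j) := rfl

theorem edgeFunctional_swap {ι : Type*} (v u : ι → Fin 3 → ℝ) (i j : ι) :
    edgeFunctional v i j u = edgeFunctional v j i u := by
  rw [edgeFunctional_apply, edgeFunctional_apply, ← neg_sub (v j), ← neg_sub (u j),
    neg_dotProduct_neg]

/-- The infinitesimal rigid motion with angular velocity `ω` and linear velocity `c`, as a linear
function of `(ω, c)`. -/
def rigidMotion {ι : Type*} (v : ι → Fin 3 → ℝ) :
    (Fin 3 → ℝ) × (Fin 3 → ℝ) →ₗ[ℝ] ι → Fin 3 → ℝ :=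
  LinearMap.pi fun i => (crossProduct.flip (v i)).coprod LinearMap.id

/-- The edges of the fan triangulation: the `n - 1` edges `{k, k + 1}`, followed by the `n - 2`
edges `{0, k + 2}`. -/
def fanEdge (n : ℕ) : Fin (n - 1) ⊕ Fin (n - 2) → Fin n × Fin n
  | .inl k => (⟨k, by lia⟩, ⟨k + 1, by lia⟩)
  | .inr k => (⟨0, by have := k.isLt; omega⟩, ⟨k + 2, by lia⟩)

theorem IsFanEdge.exists_fanEdge {n : ℕ} (hn : 3 ≤ n) {i j : Fin n} (h : IsFanEdge n i j) :
    ∃ e, fanEdge n e = (i, j) ∨ fanEdge n e = (j, i) := by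
  obtain ⟨i, hi⟩ := i
  obtain ⟨j, hj⟩ := j
  simp only [IsFanEdge] at h
  rcases h with h | ⟨h, h'⟩ | ⟨h, h', h''⟩
  · exact ⟨.inl ⟨i, by omega⟩, .inl (by simp [fanEdge, h])⟩
  · refine ⟨.inr ⟨n - 3, by omega⟩, .inr ?_⟩
    simp only [fanEdge, Prod.mk.injEq, Fin.mk.injEq]
    omega
  · refine ⟨.inr ⟨j - 2, by omega⟩, .inl ?_⟩
    simp only [fanEdge, Prod.mk.injEq, Fin.mk.injEq]
    omega

/-- **Necessity part of Theorem 1.** Fewer than `n - 3` additional linear constraints cannot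
eliminate all non-trivial infinitesimal motions of the fan-triangulated facet: for any
`m ≤ n - 4` linear functionals there is a displacement field preserving all `2n - 3` edge
constraints, annihilated by all the functionals, yet not an infinitesimal rigid motion. -/
theorem fewer_than_n_sub_three_constraints_insufficient
    (n : ℕ) (hn : 4 ≤ n) (v : Fin n → Fin 3 → ℝ)
    (hindep : ∀ i : ℕ, (h1 : 1 ≤ i) → (h2 : i ≤ n - 2) →
      AffineIndependent ℝ ![v ⟨0, by omega⟩, v ⟨i, by omega⟩, v ⟨i + 1, by omega⟩])
    (m : ℕ) (hm : m ≤ n - 4)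
    (L : Fin m → (Fin n → Fin 3 → ℝ) →ₗ[ℝ] ℝ) :
    ∃ u : Fin n → Fin 3 → ℝ,
      (∀ i j : Fin n, IsFanEdge n i j → (v i - v j) ⬝ᵥ (u i - u j) = 0) ∧
      (∀ p : Fin m, L p u = 0) ∧
      ¬ ∃ ω c : Fin 3 → ℝ, ∀ i : Fin n, u i = crossProduct ω (v i) + c := by
  have hdim : Module.finrank ℝ ((Fin 3 → ℝ) × (Fin 3 → ℝ)) +
      Module.finrank ℝ ((Fin (n - 1) ⊕ Fin (n - 2) → ℝ) × (Fin m → ℝ)) <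
        Module.finrank ℝ (Fin n → Fin 3 → ℝ) := by
    simp only [Module.finrank_prod, Module.finrank_fintype_fun_eq_card, Module.finrank_pi_fintype,
      Fintype.card_sum, Fintype.card_fin, Finset.sum_const, Finset.card_univ, smul_eq_mul]
    omega
  obtain ⟨u, hu, hrigid⟩ := exists_mem_ker_notMem_range
    ((LinearMap.pi fun e => edgeFunctional v (fanEdge n e).1 (fanEdge n e).2).prod
      (LinearMap.pi L)) (rigidMotion v) hdim
  rw [LinearMap.prod_apply, Prod.mk_eq_zero] at hu
  refine ⟨u, fun i j hij => ?_, fun p => congrFun hu.2 p, ?_⟩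
  · obtain ⟨e, he⟩ := hij.exists_fanEdge (by omega)
    have hedge : edgeFunctional v (fanEdge n e).1 (fanEdge n e).2 u = 0 := congrFun hu.1 e
    rw [← edgeFunctional_apply]
    rcases he with he | he <;> rw [he] at hedge
    · exact hedge
    · rw [edgeFunctional_swap, hedge]
  · rintro ⟨ω, c, h⟩
    exact hrigid ⟨(ω, c), funext fun i => (h i).symm⟩
end

section
/- For every n ≥ 4 and every index j with 1 ≤ j ≤ n−3, there exist points v₀, …, v_{n−1} in ℝ³ such that every consecutive triple (v₀, vᵢ, vᵢ₊₁), 1 ≤ i ≤ n−2, is affinely independent, the sub-planarity constraints ((vᵢ − v₀) × (vᵢ₊₁ − v₀)) ⋅ (vᵢ₊₂ − v₀) = 0 hold for all i ∈ {1, …, n−3} with i ≠ j, and the points v₀, …, v_{n−1} do not all lie in a common affine plane. (Hence none of the n−3 sub-planarity constraints of the fan triangulation is redundant.) -/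
open Matrix

/-- The origin together with two linearly independent vectors is affinely independent. -/
theorem affineIndependent_zero_of_linearIndependent_pair {V : Type*} [AddCommGroup V]
    [Module ℝ V] {a b : V} (h : LinearIndependent ℝ ![a, b]) :
    AffineIndependent ℝ ![0, a, b] := by
  rw [LinearIndependent.pair_iff] at h
  rw [affineIndependent_iff_of_fintype]
  intro w hw hs
  rw [Finset.weightedVSub_eq_linear_combination _ hw] at hs
  simp only [Fin.sum_univ_three, cons_val_zero, cons_val_one, cons_val_two,
    smul_zero, zero_add] at hs hw
  obtain ⟨h1, h2⟩ := h _ _ hs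
  have h0 : w 0 = 0 := by simpa [h1, h2] using hw
  intro i
  fin_cases i <;> assumption

/-- The facet based at the origin whose vertices alternate between the first two coordinate
vectors up to index `j + 1`, and between the last two from index `j + 1` on. -/
def twoPlaneFan (j : ℕ) (i : ℕ) : Fin 3 → ℝ :=
  if i = 0 then 0
  else if i % 2 = (j + 1) % 2 then ![0, 1, 0]
  else if i ≤ j then ![1, 0, 0]
  else ![0, 0, 1]

theorem twoPlaneFan_zero (j : ℕ) : twoPlaneFan j 0 = 0 := if_pos rfl

theorem linearIndependent_twoPlaneFan (j : ℕ) {i : ℕ} (hi : 1 ≤ i) :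
    LinearIndependent ℝ ![twoPlaneFan j i, twoPlaneFan j (i + 1)] := by
  rw [LinearIndependent.pair_iff]
  intro s t hst
  have h0 := congrFun hst 0
  have h1 := congrFun hst 1
  have h2 := congrFun hst 2
  simp only [twoPlaneFan] at h0 h1 h2
  split_ifs at h0 h1 h2 <;> first | omega | simp_all

theorem twoPlaneFan_tripleProduct_eq_zero {i j : ℕ} (hi : 1 ≤ i) (hij : i ≠ j) :
    crossProduct (twoPlaneFan j i) (twoPlaneFan j (i + 1)) ⬝ᵥ twoPlaneFan j (i + 2) = 0 := by
  simp only [twoPlaneFan]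
  split_ifs <;> first | omega | simp [crossProduct, dotProduct, Fin.sum_univ_three]

/-- A submodule of `ℝ³` containing the three coordinate vectors has dimension three. -/
theorem finrank_eq_three_of_basis_mem {D : Submodule ℝ (Fin 3 → ℝ)}
    (h0 : ![1, 0, 0] ∈ D) (h1 : ![0, 1, 0] ∈ D) (h2 : ![0, 0, 1] ∈ D) :
    Module.finrank ℝ D = 3 := by
  have hD : D = ⊤ := by
    refine (Submodule.eq_top_iff').2 fun x => ?_
    have hx : x = x 0 • ![1, 0, 0] + x 1 • ![0, 1, 0] + x 2 • ![0, 0, 1] := by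
      ext k
      fin_cases k <;> simp
    rw [hx]
    exact D.add_mem (D.add_mem (D.smul_mem _ h0) (D.smul_mem _ h1)) (D.smul_mem _ h2)
  rw [hD, finrank_top, Module.finrank_fin_fun]

/-- **No sub-planarity constraint is redundant.** For every `n ≥ 4` and every
`j` with `1 ≤ j ≤ n - 3`, there is a configuration of vertices of an `n`-sided facet (with
every fan triangle nondegenerate) satisfying all sub-planarity constraints except the
`j`-th one, whose vertices do not all lie in a common affine plane. -/
theorem subplanarity_constraint_not_redundant
    (n : ℕ) (hn : 4 ≤ n) (j : ℕ) (hj1 : 1 ≤ j) (hj2 : j ≤ n - 3) :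
    ∃ v : ℕ → Fin 3 → ℝ,
      (∀ i : ℕ, 1 ≤ i → i ≤ n - 2 →
        AffineIndependent ℝ ![v 0, v i, v (i + 1)]) ∧
      (∀ i : ℕ, 1 ≤ i → i ≤ n - 3 → i ≠ j →
        (crossProduct (v i - v 0) (v (i + 1) - v 0)) ⬝ᵥ (v (i + 2) - v 0) = 0) ∧
      ¬ ∃ P : AffineSubspace ℝ (Fin 3 → ℝ),
          Module.finrank ℝ P.direction ≤ 2 ∧ ∀ i : ℕ, i ≤ n - 1 → v i ∈ P := by
  refine ⟨twoPlaneFan j, fun i hi _ => ?_, fun i hi _ hij => ?_, ?_⟩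
  · rw [twoPlaneFan_zero]
    exact affineIndependent_zero_of_linearIndependent_pair (linearIndependent_twoPlaneFan j hi)
  · simpa only [twoPlaneFan_zero, sub_zero] using twoPlaneFan_tripleProduct_eq_zero hi hij
  · rintro ⟨P, hP, hv⟩
    have hdir : ∀ i ≤ n - 1, twoPlaneFan j i ∈ P.direction := fun i hi => by
      simpa [twoPlaneFan_zero] using
        AffineSubspace.vsub_mem_direction (hv i hi) (hv 0 (Nat.zero_le _))
    have e0 : twoPlaneFan j j = ![1, 0, 0] := by
      unfold twoPlaneFan
      split_ifs <;> first | contradiction | omega | rfl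
    have e1 : twoPlaneFan j (j + 1) = ![0, 1, 0] := by
      unfold twoPlaneFan
      split_ifs <;> first | contradiction | omega | rfl
    have e2 : twoPlaneFan j (j + 2) = ![0, 0, 1] := by
      unfold twoPlaneFan
      split_ifs <;> first | contradiction | omega | rfl
    have h3 := finrank_eq_three_of_basis_mem (e0 ▸ hdir j (by omega))
      (e1 ▸ hdir (j + 1) (by omega)) (e2 ▸ hdir (j + 2) (by omega))
    omega
end

section
/- Let n ≥ 3 and let v₀, …, v_{n−1} be points in ℝ³ such that for every i with 1 ≤ i ≤ n−2 the triple (v₀, vᵢ, vᵢ₊₁) is affinely independent. Then the family of 2n−3 edge rows {r_e : e an edge of the fan triangulation}, where for an edge {i, j} the row r_{ij} ∈ (Fin n → ℝ³) is given by r_{ij}(i) = vᵢ − vⱼ, r_{ij}(j) = vⱼ − vᵢ and r_{ij}(l) = 0 otherwise, is linearly independent over ℝ. (Equivalently, the edge and no-shear constraints of the fan-triangulated n-sided facet contribute rank exactly 2n−3 to the rigidity matrix, as claimed in the proof of Theorem 1.) -/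
open Matrix

/-- The row of the infinitesimal rigidity matrix corresponding to the edge `{i, j}`:
it equals `v i - v j` at vertex `i`, `v j - v i` at vertex `j`, and `0` elsewhere. -/
def edgeRow {n : ℕ} (v : Fin n → Fin 3 → ℝ) (i j : Fin n) : Fin n → Fin 3 → ℝ :=
  fun l => if l = i then v i - v j else if l = j then v j - v i else 0

/-- The edge vectors at the middle point of an affinely independent triple are linearly
independent. -/
theorem AffineIndependent.eq_zero_of_smul_sub_add_smul_sub {V : Type*} [AddCommGroup V]
    [Module ℝ V] {a b c : V} (h : AffineIndependent ℝ ![a, b, c]) {x y : ℝ}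
    (hxy : x • (b - a) + y • (b - c) = 0) : x = 0 ∧ y = 0 := by
  rw [affineIndependent_iff] at h
  have key := h Finset.univ ![-x, x + y, -y] (by simp [Fin.sum_univ_three]) (by
    rw [← hxy]
    simp only [Fin.sum_univ_three, Matrix.cons_val]
    module)
  have hx := key 0 (Finset.mem_univ _)
  have hy := key 2 (Finset.mem_univ _)
  simp only [Matrix.cons_val] at hx hy
  exact ⟨neg_eq_zero.mp hx, neg_eq_zero.mp hy⟩

theorem edgeRow_left {n : ℕ} (v : Fin n → Fin 3 → ℝ) (i j : Fin n) :
    edgeRow v i j i = v i - v j := by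
  simp [edgeRow]

theorem edgeRow_right {n : ℕ} (v : Fin n → Fin 3 → ℝ) {i j : Fin n} (h : j ≠ i) :
    edgeRow v i j j = v j - v i := by
  simp [edgeRow, h]

theorem edgeRow_of_ne {n : ℕ} (v : Fin n → Fin 3 → ℝ) {i j l : Fin n} (hi : l ≠ i)
    (hj : l ≠ j) : edgeRow v i j l = 0 := by
  simp [edgeRow, hi, hj]

/-- A linear relation among the fan edge rows vanishes on every edge incident to a vertex
other than the apex. -/
theorem fan_relation_eq_zero_of_incident {n : ℕ} (hn : 3 ≤ n) (v : Fin n → Fin 3 → ℝ)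
    (hindep : ∀ (i : ℕ) (h0 : 0 < n) (hi : i + 1 < n), 1 ≤ i →
      AffineIndependent ℝ ![v ⟨0, h0⟩, v ⟨i, Nat.lt_of_succ_lt hi⟩, v ⟨i + 1, hi⟩])
    [Fintype {p : Fin n × Fin n // IsFanEdge n p.1 p.2}]
    (g : {p : Fin n × Fin n // IsFanEdge n p.1 p.2} → ℝ)
    (hg : ∑ e, g e • edgeRow v e.1.1 e.1.2 = 0) (k : Fin n) (hk : 1 ≤ (k : ℕ))
    (e : {p : Fin n × Fin n // IsFanEdge n p.1 p.2}) (he : k = e.1.1 ∨ k = e.1.2) :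
    g e = 0 := by
  obtain ⟨k, hkn⟩ := k
  induction k using Nat.strong_induction_on generalizing e with
  | _ k ih =>
  simp only at hk
  have hsum : ∑ e, g e • edgeRow v e.1.1 e.1.2 ⟨k, hkn⟩ = 0 := by
    simpa using congrFun hg ⟨k, hkn⟩
  rcases Nat.lt_or_ge (n - 2) k with hlast | hmid
  · obtain rfl : k = n - 1 := by omega
    let s : {p : Fin n × Fin n // IsFanEdge n p.1 p.2} :=
      ⟨(⟨n - 1, hkn⟩, ⟨0, by omega⟩), Or.inr (Or.inl ⟨rfl, rfl⟩)⟩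
    have hprev : ∀ c, c ≠ s → (⟨n - 1, hkn⟩ = c.1.1 ∨ ⟨n - 1, hkn⟩ = c.1.2) → g c = 0 := by
      rintro ⟨⟨⟨i, hi⟩, ⟨j, hj⟩⟩, hc⟩ hcs hinc
      simp only [s, ne_eq, Subtype.ext_iff, Prod.ext_iff, Fin.ext_iff, IsFanEdge]
        at hc hcs hinc
      exact ih i (by omega) _ hi (show 1 ≤ i by omega) (Or.inl rfl)
    by_cases hes : e = s
    swap
    · exact hprev e hes he
    rw [Fintype.sum_eq_single s, edgeRow_left] at hsum
    swap
    · intro c hcs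
      by_cases hinc : ⟨n - 1, hkn⟩ = c.1.1 ∨ ⟨n - 1, hkn⟩ = c.1.2
      · rw [hprev c hcs hinc, zero_smul]
      · push Not at hinc
        rw [edgeRow_of_ne v hinc.1 hinc.2, smul_zero]
    have hne : v ⟨n - 1, hkn⟩ ≠ v ⟨0, by omega⟩ := by
      have hinj := (hindep (n - 2) (by omega) (by omega) (by omega)).injective.ne
        (show (2 : Fin 3) ≠ 0 by decide)
      simpa [show n - 2 + 1 = n - 1 by omega] using hinj
    rw [hes]
    exact (smul_eq_zero.mp hsum).resolve_right (sub_ne_zero.mpr hne)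
  · have hspoke : IsFanEdge n ⟨0, by omega⟩ ⟨k, hkn⟩ := by
      simp only [IsFanEdge, true_and]
      omega
    let s : {p : Fin n × Fin n // IsFanEdge n p.1 p.2} := ⟨(⟨0, by omega⟩, ⟨k, hkn⟩), hspoke⟩
    let t : {p : Fin n × Fin n // IsFanEdge n p.1 p.2} :=
      ⟨(⟨k, hkn⟩, ⟨k + 1, by omega⟩), Or.inl rfl⟩
    have hst : s ≠ t := by
      simp only [s, t, ne_eq, Subtype.ext_iff, Prod.ext_iff, Fin.ext_iff]
      omega
    have hprev : ∀ c, c ≠ s ∧ c ≠ t → (⟨k, hkn⟩ = c.1.1 ∨ ⟨k, hkn⟩ = c.1.2) → g c = 0 := by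
      rintro ⟨⟨⟨i, hi⟩, ⟨j, hj⟩⟩, hc⟩ hcs hinc
      simp only [s, t, ne_eq, Subtype.ext_iff, Prod.ext_iff, Fin.ext_iff, IsFanEdge]
        at hc hcs hinc
      exact ih i (by omega) _ hi (show 1 ≤ i by omega) (Or.inl rfl)
    rw [Fintype.sum_eq_add s t hst, edgeRow_left, edgeRow_right] at hsum
    · obtain ⟨hs, ht⟩ :=
        (hindep k (by omega) (by omega) hk).eq_zero_of_smul_sub_add_smul_sub hsum
      by_cases hes : e = s
      · rw [hes, hs]
      by_cases het : e = t
      · rw [het, ht]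
      exact hprev e ⟨hes, het⟩ he
    · simp only [s, ne_eq, Fin.mk.injEq]
      omega
    · intro c hcst
      by_cases hinc : ⟨k, hkn⟩ = c.1.1 ∨ ⟨k, hkn⟩ = c.1.2
      · rw [hprev c hcst hinc, zero_smul]
      · push Not at hinc
        rw [edgeRow_of_ne v hinc.1 hinc.2, smul_zero]

/-- **Rank count of Theorem 1.** For a fan-triangulated `n`-sided facet with nondegenerate
fan triangles, the family of `2n - 3` edge-constraint rows, indexed by the edges of the fan
triangulation, is linearly independent: the edge and no-shear constraints contribute rank
exactly `2n - 3` to the rigidity matrix. -/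
theorem fan_edge_rows_linearIndependent
    (n : ℕ) (hn : 3 ≤ n) (v : Fin n → Fin 3 → ℝ)
    (hindep : ∀ i : ℕ, (h1 : 1 ≤ i) → (h2 : i ≤ n - 2) →
      AffineIndependent ℝ ![v ⟨0, by omega⟩, v ⟨i, by omega⟩, v ⟨i + 1, by omega⟩]) :
    LinearIndependent ℝ
      (fun e : {p : Fin n × Fin n // IsFanEdge n p.1 p.2} =>
        edgeRow v e.1.1 e.1.2) := by
  classical
  rw [Fintype.linearIndependent_iff]
  rintro g hg ⟨⟨i, j⟩, hij⟩
  have hrel := fan_relation_eq_zero_of_incident hn v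
    (fun i _ hi h1 => hindep i h1 (by omega)) g hg
  by_cases hi : 1 ≤ (i : ℕ)
  · exact hrel i hi _ (Or.inl rfl)
  · refine hrel j ?_ _ (Or.inr rfl)
    simp only [IsFanEdge] at hij
    omega
end

section
/- Let n ≥ 3 and let v₀, …, v_{n−1} be points in ℝ³ such that for every i with 1 ≤ i ≤ n−2 the triple (v₀, vᵢ, vᵢ₊₁) is affinely independent. Then the subspace of displacement fields u : Fin n → ℝ³ satisfying (vᵢ − vⱼ) ⋅ (u(i) − u(j)) = 0 for every edge {i, j} of the fan triangulation has dimension exactly 3n − (2n − 3) = n + 3. (This is the kernel-dimension count underlying the rank argument in the proof of Theorem 1.) -/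
open Matrix

/-- Over three affinely independent points, the dot products against two edge vectors at a
common vertex can be prescribed independently. -/
theorem AffineIndependent.exists_dotProduct_eq {m : ℕ} {a b c : Fin m → ℝ}
    (h : AffineIndependent ℝ ![a, b, c]) (s t : ℝ) :
    ∃ x : Fin m → ℝ, (c - a) ⬝ᵥ x = s ∧ (c - b) ⬝ᵥ x = t := by
  rw [affineIndependent_iff_linearIndependent_vsub ℝ _ (2 : Fin 3)] at h
  let f : Fin 2 → {x : Fin 3 // x ≠ 2} := ![⟨0, by decide⟩, ⟨1, by decide⟩]
  have hf : Function.Injective f := by decide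
  let M : Matrix (Fin 2) (Fin m) ℝ := Matrix.of ![a - c, b - c]
  have hM : LinearIndependent ℝ M.row := by
    have hrow : M.row = (fun i : {x : Fin 3 // x ≠ 2} => ![a, b, c] i -ᵥ ![a, b, c] 2) ∘ f := by
      ext i j
      fin_cases i <;> simp [f, M]
    rw [hrow]
    exact h.comp f hf
  have hsurj : Function.Surjective M.mulVecLin := by
    rw [← LinearMap.range_eq_top]
    apply Submodule.eq_top_of_finrank_eq
    have := hM.rank_matrix
    rw [Matrix.rank] at this
    simpa using this
  obtain ⟨x, hx⟩ := hsurj ![-s, -t]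
  have h0 : (a - c) ⬝ᵥ x = -s := congrFun hx 0
  have h1 : (b - c) ⬝ᵥ x = -t := congrFun hx 1
  rw [sub_dotProduct] at h0 h1
  refine ⟨x, ?_, ?_⟩ <;> rw [sub_dotProduct] <;> linarith

/-- The linear map sending a displacement field to its first-order length changes along the
edges of the fan triangulation: first those at vertex `0`, then those joining consecutive
nonzero vertices. -/
def fanRigidityMap (m : ℕ) (v : Fin (m + 2) → Fin 3 → ℝ) :
    (Fin (m + 2) → Fin 3 → ℝ) →ₗ[ℝ] (Fin (m + 1) → ℝ) × (Fin m → ℝ) where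
  toFun u := (fun k => (v k.succ - v 0) ⬝ᵥ (u k.succ - u 0),
    fun k => (v k.succ.succ - v k.castSucc.succ) ⬝ᵥ (u k.succ.succ - u k.castSucc.succ))
  map_add' u w := by
    ext k <;> simp [dotProduct_sub, dotProduct_add] <;> ring
  map_smul' r u := by
    ext k <;> simp [dotProduct_sub, dotProduct_smul] <;> ring

theorem fanRigidityMap_surjective {m : ℕ} (hm : 1 ≤ m) {v : Fin (m + 2) → Fin 3 → ℝ}
    (h : ∀ k : Fin m, AffineIndependent ℝ ![v 0, v k.castSucc.succ, v k.succ.succ]) :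
    Function.Surjective (fanRigidityMap m v) := by
  rintro ⟨a, b⟩
  obtain ⟨x₁, hx₁⟩ : ∃ x, (v 1 - v 0) ⬝ᵥ x = a 0 := by
    obtain ⟨x, hs, ht⟩ := (h ⟨0, hm⟩).exists_dotProduct_eq (a 0) 0
    refine ⟨x, ?_⟩
    have h1 : (Fin.castSucc (⟨0, hm⟩ : Fin m)).succ = 1 := by ext; simp
    rw [h1, sub_dotProduct] at ht
    rw [sub_dotProduct] at hs ⊢
    linarith
  have step : ∀ (k : ℕ) (y : Fin 3 → ℝ), ∃ x : Fin 3 → ℝ, ∀ hk : k < m,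
      (v (⟨k, hk⟩ : Fin m).succ.succ - v 0) ⬝ᵥ x = a (⟨k, hk⟩ : Fin m).succ ∧
      (v (⟨k, hk⟩ : Fin m).succ.succ - v (⟨k, hk⟩ : Fin m).castSucc.succ) ⬝ᵥ (x - y) =
        b ⟨k, hk⟩ := by
    intro k y
    by_cases hk : k < m
    · obtain ⟨x, hs, ht⟩ := (h ⟨k, hk⟩).exists_dotProduct_eq (a (⟨k, hk⟩ : Fin m).succ)
        (b ⟨k, hk⟩ +
          (v (⟨k, hk⟩ : Fin m).succ.succ - v (⟨k, hk⟩ : Fin m).castSucc.succ) ⬝ᵥ y)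
      exact ⟨x, fun _ => ⟨hs, by rw [dotProduct_sub, ht]; ring⟩⟩
    · exact ⟨0, fun hk' => absurd hk' hk⟩
  choose g hg using step
  let z : ℕ → Fin 3 → ℝ := fun k => Nat.rec x₁ g k
  refine ⟨Fin.cons 0 fun k => z k, ?_⟩
  ext k
  · simp only [fanRigidityMap, LinearMap.coe_mk, AddHom.coe_mk, Fin.cons_succ, Fin.cons_zero,
      sub_zero]
    refine Fin.cases ?_ (fun k => ?_) k
    · exact hx₁
    · exact (hg k (z k) k.isLt).1
  · simp only [fanRigidityMap, LinearMap.coe_mk, AddHom.coe_mk, Fin.cons_succ]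
    exact (hg k (z k) k.isLt).2

theorem mem_ker_fanRigidityMap_iff {m : ℕ} (hm : 1 ≤ m) {v u : Fin (m + 2) → Fin 3 → ℝ} :
    u ∈ LinearMap.ker (fanRigidityMap m v) ↔
      ∀ i j, IsFanEdge (m + 2) i j → (v i - v j) ⬝ᵥ (u i - u j) = 0 := by
  have comm : ∀ i j, (v i - v j) ⬝ᵥ (u i - u j) = (v j - v i) ⬝ᵥ (u j - u i) := fun i j => by
    rw [← neg_sub (v j), ← neg_sub (u j), neg_dotProduct_neg]
  rw [LinearMap.mem_ker]
  constructor
  · intro hu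
    have h1 : ∀ i : Fin (m + 2), (v i - v 0) ⬝ᵥ (u i - u 0) = 0 := fun i => by
      refine Fin.cases (by simp) (fun k => ?_) i
      exact congrFun (congrArg Prod.fst hu) k
    have h2 : ∀ k : Fin m, (v k.succ.succ - v k.castSucc.succ) ⬝ᵥ
        (u k.succ.succ - u k.castSucc.succ) = 0 := fun k =>
      congrFun (congrArg Prod.snd hu) k
    intro i j hij
    by_cases hi : i = 0
    · rw [hi, comm, h1]
    by_cases hj : j = 0
    · rw [hj, h1]
    rw [Fin.ext_iff, Fin.val_zero] at hi hj
    have e : (i : ℕ) + 1 = j := by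
      rcases hij with h | h | h <;> omega
    have := h2 ⟨i - 1, by omega⟩
    have ej : (⟨i - 1, by omega⟩ : Fin m).succ.succ = j := by
      ext; simp only [Fin.val_succ]; omega
    have ei : (⟨i - 1, by omega⟩ : Fin m).castSucc.succ = i := by
      ext; simp only [Fin.val_succ, Fin.val_castSucc]; omega
    rwa [ej, ei, comm] at this
  · intro hu
    ext k
    · change (v k.succ - v 0) ⬝ᵥ (u k.succ - u 0) = 0
      by_cases hk : (k : ℕ) = m
      · exact hu _ _ (.inr (.inl ⟨by simp [hk], rfl⟩))
      · rw [comm]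
        apply hu
        by_cases hk0 : (k : ℕ) = 0
        · exact .inl (by simp [hk0])
        · exact .inr (.inr ⟨rfl, by rw [Fin.val_succ]; omega, by rw [Fin.val_succ]; omega⟩)
    · change (v k.succ.succ - v k.castSucc.succ) ⬝ᵥ (u k.succ.succ - u k.castSucc.succ) = 0
      rw [comm]
      exact hu _ _ (.inl (by simp))

/-- **Kernel-dimension count of Theorem 1.** For a fan-triangulated `n`-sided facet with
nondegenerate fan triangles, the subspace of displacement fields preserving all `2n - 3`
edge constraints has dimension exactly `3n - (2n - 3) = n + 3`. -/
theorem fan_edge_constraint_kernel_dim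
    (n : ℕ) (hn : 3 ≤ n) (v : Fin n → Fin 3 → ℝ)
    (hindep : ∀ i : ℕ, (h1 : 1 ≤ i) → (h2 : i ≤ n - 2) →
      AffineIndependent ℝ ![v ⟨0, by omega⟩, v ⟨i, by omega⟩, v ⟨i + 1, by omega⟩]) :
    ∃ W : Submodule ℝ (Fin n → Fin 3 → ℝ),
      (∀ u : Fin n → Fin 3 → ℝ,
        u ∈ W ↔ ∀ i j : Fin n, IsFanEdge n i j → (v i - v j) ⬝ᵥ (u i - u j) = 0) ∧
      Module.finrank ℝ W = n + 3 := by
  obtain ⟨m, rfl⟩ : ∃ m, n = m + 2 := ⟨n - 2, by omega⟩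
  have hm : 1 ≤ m := by omega
  refine ⟨LinearMap.ker (fanRigidityMap m v), fun u => mem_ker_fanRigidityMap_iff hm, ?_⟩
  have hsurj : Function.Surjective (fanRigidityMap m v) :=
    fanRigidityMap_surjective hm fun k => hindep (k + 1) (by omega) (by omega)
  have hrank := (fanRigidityMap m v).finrank_range_add_finrank_ker
  rw [LinearMap.range_eq_top.mpr hsurj, finrank_top] at hrank
  simp only [Module.finrank_prod, Module.finrank_pi_fintype, Module.finrank_self,
    Finset.sum_const, Finset.card_univ, Fintype.card_fin, smul_eq_mul] at hrank
  omega
end
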